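/- Every comodule over a coalgebra C is the directed union (filtered colimit) of its finite-dimensional subcomodules; in particular every element of a C-comodule lies in a finite-dimensional subcomodule. -/

import Mathlib

open TensorProduct

variable {k : Type*} [Field k]
  {C : Type*} [AddCommGroup C] [Module k C] [Coalgebra k C]
  {M : Type*} [AddCommGroup M] [Module k M]

/-- `γ : M → M ⊗ C` is a right `C`-comodule structure. -/
def IsComodule (γ : M →ₗ[k] M ⊗[k] C) : Prop :=
  (∀ m, (TensorProduct.rid k M)
      ((TensorProduct.map LinearMap.id (Coalgebra.counit (R := k) (A := C))) (γ m)) = m) ∧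
  (∀ m, (TensorProduct.assoc k M C C)
      ((TensorProduct.map γ LinearMap.id) (γ m)) =
    (TensorProduct.map LinearMap.id (Coalgebra.comul (R := k) (A := C))) (γ m))

/-- A submodule `N ≤ M` is a subcomodule if the coaction sends `N` into
(the image of) `N ⊗ C`. -/
def IsSubcomodule (γ : M →ₗ[k] M ⊗[k] C) (N : Submodule k M) : Prop :=
  ∀ x ∈ N, γ x ∈ LinearMap.range
    (TensorProduct.map N.subtype (LinearMap.id : C →ₗ[k] C))

section Contraction

variable {D : Type*} [AddCommGroup D] [Module k D]

/-- The contraction `M ⊗ D → M` along a linear functional on `D`, applied to a fixed tensor,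
as a linear map in the functional. -/
noncomputable def contractAlong (t : M ⊗[k] D) : Module.Dual k D →ₗ[k] M :=
  (TensorProduct.rid k M).toLinearMap ∘ₗ LinearMap.applyₗ t ∘ₗ LinearMap.lTensorHom M

theorem contractAlong_apply (t : M ⊗[k] D) (f : Module.Dual k D) :
    contractAlong t f = TensorProduct.rid k M (f.lTensor M t) := rfl

theorem finiteDimensional_range_contractAlong (t : M ⊗[k] D) :
    FiniteDimensional k (LinearMap.range (contractAlong t)) := by
  classical
  obtain ⟨S, rfl⟩ := TensorProduct.exists_finset t
  have hfin := FiniteDimensional.span_finset k (S.image Prod.fst)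
  refine Submodule.finiteDimensional_of_le (S₂ := Submodule.span k (S.image Prod.fst)) ?_
  rintro _ ⟨f, rfl⟩
  simp only [contractAlong_apply, map_sum, LinearMap.lTensor_tmul, TensorProduct.rid_tmul]
  exact Submodule.sum_mem _ fun p hp => Submodule.smul_mem _ _
    (Submodule.subset_span (Finset.mem_coe.2 (Finset.mem_image_of_mem _ hp)))

theorem mem_range_map_range_contractAlong (t : M ⊗[k] D) :
    t ∈ LinearMap.range (TensorProduct.map (LinearMap.range (contractAlong t)).subtype
      (LinearMap.id : D →ₗ[k] D)) := by
  classical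
  let b := Module.Basis.ofVectorSpace k D
  let e := TensorProduct.equivFinsuppOfBasisRight (M := M) b
  have ht : t = (e t).sum fun i m => m ⊗ₜ b i := by
    rw [← TensorProduct.equivFinsuppOfBasisRight_symm_apply, LinearEquiv.symm_apply_apply]
  have hmem : ∀ i, e t i ∈ LinearMap.range (contractAlong t) := fun i =>
    ⟨b.coord i, (TensorProduct.equivFinsuppOfBasisRight_apply b t i).symm⟩
  refine ⟨(e t).support.sum fun i => ⟨e t i, hmem i⟩ ⊗ₜ b i, ?_⟩
  simp only [map_sum, TensorProduct.map_tmul, Submodule.subtype_apply, LinearMap.id_apply]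
  exact ht.symm

end Contraction

theorem coaction_contractAlong {γ : M →ₗ[k] M ⊗[k] C} (hγ : IsComodule γ) (m : M)
    (f : Module.Dual k C) :
    γ (contractAlong (γ m) f) =
      (((TensorProduct.rid k C).toLinearMap ∘ₗ f.lTensor C ∘ₗ
        Coalgebra.comul (R := k)).lTensor M) (γ m) := by
  have hleft : ∀ t : M ⊗[k] C, γ (contractAlong t f) =
      ((TensorProduct.rid k C).toLinearMap ∘ₗ f.lTensor C).lTensor M
        (TensorProduct.assoc k M C C (TensorProduct.map γ LinearMap.id t)) := by
    intro t
    induction t with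
    | zero => simp [contractAlong_apply]
    | add x y hx hy => simp_all [contractAlong_apply]
    | tmul x c =>
      simp only [contractAlong_apply, LinearMap.lTensor_tmul, TensorProduct.rid_tmul, map_smul,
        TensorProduct.map_tmul, LinearMap.id_apply]
      induction γ x with
      | zero => simp
      | add u v hu hv => simp only [smul_add, hu, hv, TensorProduct.add_tmul, map_add]
      | tmul y d => simp
  rw [hleft, hγ.2 m, ← LinearMap.comp_assoc, LinearMap.lTensor_comp _ (_ ∘ₗ _)]
  rfl

theorem isSubcomodule_range_contractAlong {γ : M →ₗ[k] M ⊗[k] C} (hγ : IsComodule γ) (m : M) :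
    IsSubcomodule γ (LinearMap.range (contractAlong (γ m))) := by
  rintro _ ⟨f, rfl⟩
  rw [coaction_contractAlong hγ]
  obtain ⟨s, hs⟩ := mem_range_map_range_contractAlong (γ m)
  generalize (TensorProduct.rid k C).toLinearMap ∘ₗ f.lTensor C ∘ₗ Coalgebra.comul (R := k) = g
  refine ⟨g.lTensor _ s, ?_⟩
  conv_rhs => rw [← hs]
  simp only [LinearMap.lTensor, ← LinearMap.comp_apply, ← TensorProduct.map_comp,
    LinearMap.comp_id, LinearMap.id_comp]

/-- Fundamental theorem of comodules (local finiteness): every comodule is the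
directed union of its finite-dimensional subcomodules; in particular every
element lies in a finite-dimensional subcomodule. -/
theorem comodule_is_union_of_finite_dimensional_subcomodules
    (γ : M →ₗ[k] M ⊗[k] C) (hγ : IsComodule γ) :
    (∀ m : M, ∃ N : Submodule k M,
      IsSubcomodule γ N ∧ FiniteDimensional k N ∧ m ∈ N) ∧
    sSup {N : Submodule k M | IsSubcomodule γ N ∧ FiniteDimensional k N} = ⊤ := by
  have hex : ∀ m : M, ∃ N : Submodule k M,
      IsSubcomodule γ N ∧ FiniteDimensional k N ∧ m ∈ N := fun m =>
    ⟨LinearMap.range (contractAlong (γ m)), isSubcomodule_range_contractAlong hγ m,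
      finiteDimensional_range_contractAlong _, Coalgebra.counit, hγ.1 m⟩
  refine ⟨hex, eq_top_iff.2 fun m _ => ?_⟩
  obtain ⟨N, hN, hfin, hm⟩ := hex m
  have hle : N ≤ sSup {N : Submodule k M | IsSubcomodule γ N ∧ FiniteDimensional k N} :=
    le_sSup ⟨hN, hfin⟩
  exact hle hm
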